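/- arXiv:2502.08046 — 4 statements merged into one kernel-verified Lean document; each statement's English description precedes it below -/
import Mathlib

section
/- For all constants c > 0 and K > 0 there exists N such that for all n = rm ≥ N with integers r ≥ 3, m ≥ 1 and integer d with 1 ≤ d ≤ m^{r−1} − 1 satisfying Λ ≥ c·r^{16}·m^{2−r}: ∫_{𝓑₁} |F(θ)| dθ ≤ e^{−K·r·n·log n} · m^{(r−1)/2} · (2π/(Λ m^{r−1}))^{(n−r+1)/2}, where 𝓑₁ is the set of θ ∈ 𝓑 such that there is a class index t ∈ [r] with the property that for every k ∈ V_t, the number of indices j ∈ V_t with |θ_j − θ_k|_{2π} > ρ₀/(4r) exceeds m/r. -/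
open MeasureTheory Filter

/-- The edge density `λ = d / m^(r-1)`. -/
noncomputable def lam (r m d : ℕ) : ℝ := (d : ℝ) / (m : ℝ) ^ (r - 1)

/-- `Λ = λ(1−λ)`. -/
noncomputable def Lam (r m d : ℕ) : ℝ := lam r m d * (1 - lam r m d)

/-- For an edge `e ∈ (Fin m)^r` and `θ ∈ ℝ^n` (vertices indexed by `Fin r × Fin m`,
class `t` being `{t} × Fin m`), the sum `Σ_{j∈e} θ_j`. -/
def edgeSum (r m : ℕ) (θ : Fin r × Fin m → ℝ) (e : Fin r → Fin m) : ℝ :=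
  ∑ t : Fin r, θ (t, e t)

/-- The integrand `F(θ) = (∏_e (1 + λ(e^{iΣ_{j∈e}θ_j} − 1))) · e^{−i d Σ_j θ_j}`. -/
noncomputable def Ffun (r m d : ℕ) (θ : Fin r × Fin m → ℝ) : ℂ :=
  (∏ e : Fin r → Fin m,
      (1 + (lam r m d : ℂ) * (Complex.exp (Complex.I * (edgeSum r m θ e : ℂ)) - 1))) *
    Complex.exp (-Complex.I * (d : ℂ) * ((∑ p : Fin r × Fin m, θ p : ℝ) : ℂ))

/-- Vertex `p` is one of the constrained coordinates `2m, 3m, …, rm`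
(the last vertex of each class except the first). -/
def constrained (r m : ℕ) (p : Fin r × Fin m) : Prop := p.1.val ≠ 0 ∧ p.2.val = m - 1

instance (r m : ℕ) : DecidablePred (constrained r m) :=
  fun p => inferInstanceAs (Decidable (p.1.val ≠ 0 ∧ p.2.val = m - 1))

/-- Extension by zero of a vector of free coordinates to all of `ℝ^n`;
(n−r+1)-dimensional integrals over subsets of `𝓑` are realised by pulling back along it. -/
def ext (r m : ℕ) (θ : {p : Fin r × Fin m // ¬ constrained r m p} → ℝ) :
    Fin r × Fin m → ℝ :=
  fun p => if h : constrained r m p then 0 else θ ⟨p, h⟩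

/-- `ρ₀ = r^{5/2} (log n) / (Λ m^{r−1})^{1/2}`, with `n = r·m`. -/
noncomputable def rho0 (r m d : ℕ) : ℝ :=
  (r : ℝ) ^ ((5 : ℝ) / 2) * Real.log ((r : ℝ) * m) /
    Real.sqrt (Lam r m d * (m : ℝ) ^ (r - 1))

/-- `U_n(ρ) = {x ∈ ℝ^n : ‖x‖_∞ ≤ ρ}`. -/
def Uball (r m : ℕ) (ρ : ℝ) : Set (Fin r × Fin m → ℝ) := {θ | ∀ p, |θ p| ≤ ρ}

/-- `𝓑 = {θ ∈ U_n(π) : θ_{2m} = ⋯ = θ_{rm} = 0}`. -/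
def BSet (r m : ℕ) : Set (Fin r × Fin m → ℝ) :=
  {θ | (∀ p, |θ p| ≤ Real.pi) ∧ ∀ p, constrained r m p → θ p = 0}

/-- The circular distance `|x|_{2π} = min_{k∈ℤ} |x − 2πk|`. -/
noncomputable def circ (x : ℝ) : ℝ := ⨅ k : ℤ, |x - 2 * Real.pi * k|

/-- The main factor `m^{(r−1)/2} (2π/(Λ m^{r−1}))^{(n−r+1)/2}` in the estimates. -/
noncomputable def denseBound (r m d : ℕ) : ℝ :=
  (m : ℝ) ^ (((r : ℝ) - 1) / 2) *
    (2 * Real.pi / (Lam r m d * (m : ℝ) ^ (r - 1))) ^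
      ((((r * m : ℕ) : ℝ) - (r : ℝ) + 1) / 2)

/-- The region `𝓑₁` of `θ ∈ 𝓑` such that for some class `t`, every `k ∈ V_t` has more
than `m/r` indices `j ∈ V_t` with `|θ_j − θ_k|_{2π} > ρ₀/(4r)`. -/
noncomputable def B1 (r m d : ℕ) : Set (Fin r × Fin m → ℝ) :=
  {θ | θ ∈ BSet r m ∧ ∃ t : Fin r, ∀ k : Fin m,
    (m : ℝ) / (r : ℝ) <
      (Nat.card {j : Fin m // rho0 r m d / (4 * r) < circ (θ (t, j) - θ (t, k))} : ℝ)}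

lemma circ_sq_le (x : ℝ) : circ x ^ 2 ≤ Real.pi ^ 2 / 2 * (1 - Real.cos x) := by
  have hpi := Real.pi_pos
  set k : ℤ := round (x / (2 * Real.pi)) with hk
  set z : ℝ := x - 2 * Real.pi * k with hz
  have hle : circ x ≤ |z| :=
    ciInf_le ⟨0, by rintro _ ⟨k, rfl⟩; exact abs_nonneg _⟩ k
  have h0 : 0 ≤ circ x := Real.iInf_nonneg fun k => abs_nonneg _
  have hzpi : |z| ≤ Real.pi := by
    have h := abs_sub_round (x / (2 * Real.pi))
    have hzeq : z = 2 * Real.pi * (x / (2 * Real.pi) - k) := by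
      rw [hz]; field_simp
    rw [hzeq, abs_mul, abs_of_pos (by positivity)]
    nlinarith
  have hcos : Real.cos z = Real.cos x := by
    rw [hz, mul_comm]; exact Real.cos_sub_int_mul_two_pi x k
  have hq := Real.cos_le_one_sub_mul_cos_sq hzpi
  rw [hcos] at hq
  have hsq : circ x ^ 2 ≤ z ^ 2 := by rw [← sq_abs z]; gcongr
  have : Real.pi ^ 2 / 2 * (2 / Real.pi ^ 2 * z ^ 2) = z ^ 2 := by field_simp
  linarith [mul_le_mul_of_nonneg_left (show 2 / Real.pi ^ 2 * z ^ 2 ≤ 1 - Real.cos x by linarith)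
      (show 0 ≤ Real.pi ^ 2 / 2 by positivity)]

lemma one_sub_cos_sub_le (a b : ℝ) :
    1 - Real.cos (a - b) ≤ 2 * ((1 - Real.cos a) + (1 - Real.cos b)) := by
  rw [Real.cos_sub]
  nlinarith [Real.sin_sq_add_cos_sq a, Real.sin_sq_add_cos_sq b,
    sq_nonneg (Real.sin a + Real.sin b), sq_nonneg (2 - Real.cos a - Real.cos b)]

lemma circ_sub_sq_le (a b : ℝ) :
    circ (a - b) ^ 2 ≤ Real.pi ^ 2 * ((1 - Real.cos a) + (1 - Real.cos b)) := by
  have h := mul_le_mul_of_nonneg_left (one_sub_cos_sub_le a b)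
    (show 0 ≤ Real.pi ^ 2 / 2 by positivity)
  linarith [circ_sq_le (a - b)]

lemma norm_one_add_mul_exp_sub_one_le (l x : ℝ) :
    ‖1 + (l : ℂ) * (Complex.exp (Complex.I * (x : ℂ)) - 1)‖ ≤
      Real.exp (-(l * (1 - l) * (1 - Real.cos x))) := by
  have hsq : ‖1 + (l : ℂ) * (Complex.exp (Complex.I * (x : ℂ)) - 1)‖ ^ 2 =
      1 - 2 * (l * (1 - l) * (1 - Real.cos x)) := by
    rw [mul_comm Complex.I, Complex.exp_mul_I, ← Complex.normSq_eq_norm_sq,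
      Complex.normSq_apply, ← Complex.ofReal_cos, ← Complex.ofReal_sin]
    simp [-Complex.ofReal_cos, -Complex.ofReal_sin]
    linear_combination l ^ 2 * Real.sin_sq_add_cos_sq x
  refine (pow_le_pow_iff_left₀ (norm_nonneg _) (Real.exp_pos _).le two_ne_zero).1 ?_
  rw [hsq, ← Real.exp_nat_mul]
  push_cast
  linarith [Real.add_one_le_exp (2 * -(l * (1 - l) * (1 - Real.cos x)))]

lemma norm_Ffun_le (r m d : ℕ) (θ : Fin r × Fin m → ℝ) :
    ‖Ffun r m d θ‖ ≤
      Real.exp (-(Lam r m d * ∑ e : Fin r → Fin m, (1 - Real.cos (edgeSum r m θ e)))) := by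
  have hphase : ‖Complex.exp (-Complex.I * (d : ℂ) *
      ((∑ p : Fin r × Fin m, θ p : ℝ) : ℂ))‖ = 1 := by
    rw [Complex.norm_exp]; simp
  rw [Ffun, norm_mul, hphase, mul_one, norm_prod, Finset.mul_sum, ← Finset.sum_neg_distrib,
    Real.exp_sum]
  exact Finset.prod_le_prod (fun _ _ => norm_nonneg _)
    fun e _ => norm_one_add_mul_exp_sub_one_le _ _

/-- If every `a k` is far from many `a j` on the circle, then no common shift of the `a j`
brings most of them close to `0`. -/
lemma le_sum_one_sub_cos {m : ℕ} (hm : 1 ≤ m) {δ q : ℝ} (hδ : 0 ≤ δ) (a : Fin m → ℝ)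
    (h : ∀ k, q < (Nat.card {j : Fin m // δ < circ (a j - a k)} : ℝ)) (s : ℝ) :
    q * δ ^ 2 / (2 * Real.pi ^ 2) ≤ ∑ j, (1 - Real.cos (a j + s)) := by
  classical
  have hrow (k : Fin m) : q * δ ^ 2 ≤
      ∑ j, Real.pi ^ 2 * ((1 - Real.cos (a j + s)) + (1 - Real.cos (a k + s))) := by
    have hcard := (h k).le
    rw [Nat.card_eq_fintype_card, Fintype.card_subtype] at hcard
    calc q * δ ^ 2 ≤ (Finset.univ.filter fun j => δ < circ (a j - a k)).card * δ ^ 2 := by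
          gcongr
      _ = ∑ j, if δ < circ (a j - a k) then δ ^ 2 else 0 := by
          rw [← Finset.sum_filter]; simp
      _ ≤ _ := by
          refine Finset.sum_le_sum fun j _ => ?_
          have hc := circ_sub_sq_le (a j + s) (a k + s)
          rw [add_sub_add_right_eq_sub] at hc
          split_ifs with hj
          · exact (pow_le_pow_left₀ hδ hj.le 2).trans hc
          · exact (sq_nonneg _).trans hc
  have hsum := Finset.sum_le_sum fun k (_ : k ∈ Finset.univ) => hrow k
  simp only [← Finset.mul_sum, Finset.sum_add_distrib, Finset.sum_const, Finset.card_univ,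
    Fintype.card_fin, nsmul_eq_mul] at hsum
  have hm' : (0 : ℝ) < m := by exact_mod_cast hm
  rw [div_le_iff₀ (by positivity)]
  refine le_of_mul_le_mul_left ?_ hm'
  simp only [Finset.sum_sub_distrib, Finset.sum_const, Finset.card_univ,
    Fintype.card_fin, nsmul_eq_mul] at hsum ⊢
  linarith

lemma sum_edges_eq {r m : ℕ} (t : Fin r) (θ : Fin r × Fin m → ℝ) (g : ℝ → ℝ) :
    ∑ e : Fin r → Fin m, g (edgeSum r m θ e) =
      ∑ f : {s : Fin r // s ≠ t} → Fin m, ∑ j : Fin m,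
        g (θ (t, j) + ∑ s : {s : Fin r // s ≠ t}, θ (s, f s)) := by
  rw [Finset.sum_comm, ← Fintype.sum_prod_type']
  refine Fintype.sum_equiv (Equiv.funSplitAt t (Fin m)) _ _ fun e => ?_
  congr 1
  rw [edgeSum, Fintype.sum_eq_add_sum_subtype_ne _ t]
  rfl

lemma norm_Ffun_le_of_mem_B1 {r m d : ℕ} (hr : 3 ≤ r) (hm : 1 ≤ m)
    (hL : 0 < Lam r m d) {θ : Fin r × Fin m → ℝ} (hθ : θ ∈ B1 r m d) :
    ‖Ffun r m d θ‖ ≤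
      Real.exp (-((r : ℝ) * (r * m) * Real.log ((r : ℝ) * m) ^ 2 / (32 * Real.pi ^ 2))) := by
  obtain ⟨-, t, ht⟩ := hθ
  have hm' : (1 : ℝ) ≤ m := by exact_mod_cast hm
  have hr' : (3 : ℝ) ≤ r := by exact_mod_cast hr
  have hlog : 0 ≤ Real.log ((r : ℝ) * m) := Real.log_nonneg (by nlinarith)
  have hδ : 0 ≤ rho0 r m d / (4 * r) := by unfold rho0; positivity
  refine (norm_Ffun_le r m d θ).trans (Real.exp_le_exp.2 (neg_le_neg ?_))
  have hsum := Finset.sum_le_sum fun (f : {s : Fin r // s ≠ t} → Fin m)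
    (_ : f ∈ Finset.univ) => le_sum_one_sub_cos hm hδ (fun j => θ (t, j)) ht
      (∑ s : {s : Fin r // s ≠ t}, θ (s, f s))
  rw [← sum_edges_eq t θ fun x => 1 - Real.cos x] at hsum
  refine le_trans (le_of_eq ?_) (mul_le_mul_of_nonneg_left hsum hL.le)
  have hcard : Fintype.card {s : Fin r // s ≠ t} = r - 1 := by
    simp [Fintype.card_subtype_compl]
  have hrpow : ((r : ℝ) ^ ((5 : ℝ) / 2)) ^ 2 = (r : ℝ) ^ 5 := by
    rw [← Real.rpow_natCast, ← Real.rpow_mul (by positivity)]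
    norm_num
  have hM : (0 : ℝ) < (m : ℝ) ^ (r - 1) := by positivity
  have hrho : rho0 r m d ^ 2 =
      (r : ℝ) ^ 5 * Real.log ((r : ℝ) * m) ^ 2 / (Lam r m d * (m : ℝ) ^ (r - 1)) := by
    rw [rho0, div_pow, mul_pow, hrpow, Real.sq_sqrt (by positivity)]
  rw [Finset.sum_const, Finset.card_univ, Fintype.card_fun, hcard, Fintype.card_fin,
    nsmul_eq_mul, div_pow, hrho]
  push_cast
  field_simp
  ring

lemma volume_preimage_B1_le (r m d : ℕ) :
    volume (ext r m ⁻¹' B1 r m d) ≤ ENNReal.ofReal ((2 * Real.pi) ^ (r * m)) := by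
  have hsub : ext r m ⁻¹' B1 r m d ⊆
      Set.Icc (fun _ => -Real.pi) (fun _ => Real.pi) := by
    intro θ hθ
    have h (p : {p : Fin r × Fin m // ¬ constrained r m p}) :
        -Real.pi ≤ θ p ∧ θ p ≤ Real.pi := by
      simpa only [ext, dif_neg p.2] using abs_le.1 (hθ.1.1 p.1)
    exact ⟨fun p => (h p).1, fun p => (h p).2⟩
  refine (measure_mono hsub).trans ?_
  rw [Real.volume_Icc_pi]
  simp only [sub_neg_eq_add, ← two_mul, Finset.prod_const, Finset.card_univ]
  rw [← ENNReal.ofReal_pow (by positivity)]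
  refine ENNReal.ofReal_le_ofReal (pow_le_pow_right₀ (by linarith [Real.pi_gt_three]) ?_)
  simpa only [Fintype.card_prod, Fintype.card_fin] using
    Fintype.card_subtype_le fun p : Fin r × Fin m => ¬ constrained r m p

lemma Lam_pos {r m d : ℕ} (hd : 1 ≤ d) (hd' : d ≤ m ^ (r - 1) - 1) : 0 < Lam r m d := by
  have hlt : d < m ^ (r - 1) := by omega
  have hltR : (d : ℝ) < (m : ℝ) ^ (r - 1) := by exact_mod_cast hlt
  have hdR : (0 : ℝ) < d := by exact_mod_cast hd
  have hM := hdR.trans hltR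
  exact mul_pos (div_pos hdR hM) (sub_pos.2 ((div_lt_one hM).2 hltR))

lemma exp_le_denseBound {r m d : ℕ} (hr : 3 ≤ r) (hm : 1 ≤ m) (hL : 0 < Lam r m d) :
    Real.exp (-((r : ℝ) * (r * m) * Real.log ((r : ℝ) * m))) ≤ denseBound r m d := by
  have hm' : (1 : ℝ) ≤ m := by exact_mod_cast hm
  have hr' : (3 : ℝ) ≤ r := by exact_mod_cast hr
  have hM : (0 : ℝ) < (m : ℝ) ^ (r - 1) := by positivity
  have hL1 : Lam r m d ≤ 1 := by
    unfold Lam; nlinarith [sq_nonneg (lam r m d - 1 / 2)]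
  have hone : 1 ≤ (m : ℝ) ^ (((r : ℝ) - 1) / 2) := Real.one_le_rpow hm' (by linarith)
  have hlogm : 0 ≤ Real.log m := Real.log_nonneg hm'
  have hloglog : Real.log m ≤ Real.log ((r : ℝ) * m) :=
    Real.log_le_log (by linarith) (by nlinarith)
  have hbase : Real.exp (-((r : ℝ) * Real.log m)) ≤
      2 * Real.pi / (Lam r m d * (m : ℝ) ^ (r - 1)) := by
    have hpow : Real.exp ((r : ℝ) * Real.log m) = (m : ℝ) ^ r := by
      rw [mul_comm, Real.exp_mul, Real.exp_log (by linarith), Real.rpow_natCast]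
    rw [Real.exp_neg, hpow, inv_eq_one_div]
    refine div_le_div₀ (by positivity) (by linarith [Real.pi_gt_three]) (by positivity) ?_
    calc Lam r m d * (m : ℝ) ^ (r - 1) ≤ 1 * (m : ℝ) ^ (r - 1) := by gcongr
      _ ≤ (m : ℝ) ^ r := by
        rw [one_mul]; exact pow_le_pow_right₀ hm' (Nat.sub_le _ _)
  have hexp : 0 ≤ (((r * m : ℕ) : ℝ) - (r : ℝ) + 1) / 2 := by push_cast; nlinarith
  have hexp' : (((r * m : ℕ) : ℝ) - (r : ℝ) + 1) / 2 ≤ r * m := by push_cast; nlinarith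
  unfold denseBound
  calc Real.exp (-((r : ℝ) * (r * m) * Real.log ((r : ℝ) * m)))
      ≤ Real.exp (-((r : ℝ) * Real.log m) * ((((r * m : ℕ) : ℝ) - (r : ℝ) + 1) / 2)) := by
        refine Real.exp_le_exp.2 ?_
        rw [neg_mul, neg_le_neg_iff]
        have hlog := hlogm.trans hloglog
        calc _ ≤ (r : ℝ) * Real.log ((r : ℝ) * m) * (r * m) := by gcongr
          _ = _ := by ring
    _ = Real.exp (-((r : ℝ) * Real.log m)) ^ ((((r * m : ℕ) : ℝ) - (r : ℝ) + 1) / 2) :=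
        Real.exp_mul _ _
    _ ≤ (2 * Real.pi / (Lam r m d * (m : ℝ) ^ (r - 1))) ^
          ((((r * m : ℕ) : ℝ) - (r : ℝ) + 1) / 2) :=
        Real.rpow_le_rpow (Real.exp_pos _).le hbase hexp
    _ ≤ _ := le_mul_of_one_le_left (by positivity) hone

/-- for all `c, K > 0` there is `N` such that whenever `n = rm ≥ N`,
`r ≥ 3`, `1 ≤ d ≤ m^{r−1} − 1` and `Λ ≥ c·r^16·m^{2−r}`,
`∫_{𝓑₁} |F| ≤ e^{−K r n log n} · m^{(r−1)/2} (2π/(Λ m^{r−1}))^{(n−r+1)/2}`. -/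
theorem abs_integral_B1_bound (c K : ℝ) (hc : 0 < c) (hK : 0 < K) :
    ∃ N : ℕ, ∀ r m d : ℕ, 3 ≤ r → 1 ≤ m → N ≤ r * m →
      1 ≤ d → d ≤ m ^ (r - 1) - 1 →
      c * (r : ℝ) ^ 16 * (m : ℝ) ^ ((2 : ℤ) - (r : ℤ)) ≤ Lam r m d →
      (∫ θ in ext r m ⁻¹' B1 r m d, ‖Ffun r m d (ext r m θ)‖) ≤
        Real.exp (-(K * (r : ℝ) * ((r * m : ℕ) : ℝ) * Real.log ((r : ℝ) * m))) *
          denseBound r m d := by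
  obtain ⟨N, hN⟩ := exists_nat_ge (Real.exp (32 * Real.pi ^ 2 * (K + 1 + 2 * Real.pi)))
  refine ⟨N, fun r m d hr hm hn hd hd' _ => ?_⟩
  have hL := Lam_pos hd hd'
  have hm' : (1 : ℝ) ≤ m := by exact_mod_cast hm
  have hr' : (3 : ℝ) ≤ r := by exact_mod_cast hr
  have hpi := Real.pi_pos
  set L := Real.log ((r : ℝ) * m) with hLdef
  have hbig : 32 * Real.pi ^ 2 * (K + 1 + 2 * Real.pi) ≤ L := by
    rw [hLdef, Real.le_log_iff_exp_le (by positivity)]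
    exact hN.trans (by exact_mod_cast hn)
  have hL1 : 1 ≤ L := by
    refine le_trans ?_ hbig
    nlinarith [Real.pi_gt_three, mul_pos (pow_pos hpi 2) (add_pos hK hpi)]
  have hvol := volume_preimage_B1_le r m d
  have hint := norm_setIntegral_le_of_norm_le_const (hvol.trans_lt ENNReal.ofReal_lt_top)
    (f := fun θ => ‖Ffun r m d (ext r m θ)‖) fun θ hθ => by
      rw [norm_norm]
      exact norm_Ffun_le_of_mem_B1 hr hm hL hθ
  have hvolR : volume.real (ext r m ⁻¹' B1 r m d) ≤ Real.exp (2 * Real.pi * (r * m)) := by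
    refine (ENNReal.toReal_le_of_le_ofReal (by positivity) hvol).trans ?_
    calc (2 * Real.pi) ^ (r * m) ≤ Real.exp (2 * Real.pi) ^ (r * m) := by
          gcongr
          linarith [Real.add_one_le_exp (2 * Real.pi)]
      _ = _ := by rw [← Real.exp_nat_mul]; push_cast; ring_nf
  refine (Real.le_norm_self _).trans (hint.trans ?_)
  calc _ ≤ Real.exp (-((r : ℝ) * (r * m) * L ^ 2 / (32 * Real.pi ^ 2))) *
        Real.exp (2 * Real.pi * (r * m)) := by gcongr
    _ ≤ Real.exp (-(K * (r : ℝ) * ((r * m : ℕ) : ℝ) * L)) *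
        Real.exp (-((r : ℝ) * (r * m) * L)) := by
        rw [← Real.exp_add, ← Real.exp_add]
        refine Real.exp_le_exp.2 ?_
        push_cast
        have hquad : (K + 1 + 2 * Real.pi) * L ≤ L ^ 2 / (32 * Real.pi ^ 2) := by
          rw [le_div_iff₀ (by positivity)]
          nlinarith
        have hmul := mul_le_mul_of_nonneg_left hquad
          (show 0 ≤ (r : ℝ) * (r * m) by positivity)
        have hrL : 1 ≤ (r : ℝ) * L := by nlinarith
        have hlin := mul_le_mul_of_nonneg_left hrL
          (show 0 ≤ 2 * Real.pi * ((r : ℝ) * m) by positivity)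
        rw [mul_div_assoc]
        linarith
    _ ≤ _ := by
        gcongr
        exact exp_le_denseBound hr hm hL
end

section
/- For all constants c > 0 and c' > 0 there exist C > 0 and N such that for all n = rm ≥ N with integers r ≥ 3, m ≥ 1 and integer d with 1 ≤ d ≤ m^{r−1} − 1 satisfying Λ ≥ c·r^{16}·m^{2−r}, and for every θ ∈ ℝ^n with ‖θ‖_∞ ≤ c'·ρ₀, there is a complex number E with |E| ≤ C·n^{−1/2}·(log n)^5 such that F(θ) = exp( −θᵗAθ + Σ_{p=3}^{4} a_p(λ) Σ_{e ∈ (Fin m)^r} (Σ_{j∈e} θ_j)^p + E ), where a₃(λ) = −(i/6)·Λ·(1−2λ) and a₄(λ) = (1/24)·Λ·(1−6Λ). -/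
open MeasureTheory Filter

/-- The quadratic form `θᵗAθ` where `A = (Λ m^{r−1}/2)(I − B/m + J_n/m)`:
`θᵗAθ = (Λ m^{r−1}/2)(Σ_p θ_p² − (Σ_t (Σ_{j∈V_t} θ_j)²)/m + (Σ_p θ_p)²/m)`. -/
noncomputable def qA (r m d : ℕ) (θ : Fin r × Fin m → ℝ) : ℝ :=
  Lam r m d * (m : ℝ) ^ (r - 1) / 2 *
    ((∑ p : Fin r × Fin m, θ p ^ 2) -
      (∑ t : Fin r, (∑ j : Fin m, θ (t, j)) ^ 2) / m +
      (∑ p : Fin r × Fin m, θ p) ^ 2 / m)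

theorem norm_le_mul_pow_succ_of_hasDerivAt {g g' : ℝ → ℂ} {K δ : ℝ} {k : ℕ}
    (hg : ∀ x, |x| ≤ δ → HasDerivAt g (g' x) x) (h0 : g 0 = 0)
    (hK : ∀ x, |x| ≤ δ → ‖g' x‖ ≤ K * |x| ^ k) (x : ℝ) (hx : |x| ≤ δ) :
    ‖g x‖ ≤ K * |x| ^ (k + 1) := by
  have hδ : 0 ≤ δ := (abs_nonneg x).trans hx
  have hK0 : 0 ≤ K * |x| ^ k := (norm_nonneg _).trans (hK x hx)
  have hsub : ∀ y ∈ Set.uIcc 0 x, |y| ≤ |x| := fun y hy => by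
    simpa using Set.abs_sub_left_of_mem_uIcc hy
  have key := (convex_uIcc (0 : ℝ) x).norm_image_sub_le_of_norm_hasDerivWithin_le
    (f := g) (f' := g') (C := K * |x| ^ k)
    (fun y hy => (hg y ((hsub y hy).trans hx)).hasDerivWithinAt)
    (fun y hy => ?_) Set.left_mem_uIcc Set.right_mem_uIcc
  · simpa [h0, pow_succ, mul_assoc] using key
  · refine (hK y ((hsub y hy).trans hx)).trans ?_
    by_cases hK' : 0 ≤ K
    · exact mul_le_mul_of_nonneg_left (pow_le_pow_left₀ (abs_nonneg y) (hsub y hy) k) hK'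
    · have hx0 : |x| ^ k = 0 := by
        have : 0 ≤ |x| ^ k := by positivity
        nlinarith
      have : 0 ≤ |y| ^ k := by positivity
      rw [hx0]
      nlinarith

/-- The logarithm of the characteristic function of a Bernoulli variable agrees with its
fourth-order cumulant expansion up to an error proportional to the variance. -/
theorem norm_log_bernoulli_charFun_sub_le {l : ℝ} (h0 : 0 ≤ l) (h1 : l ≤ 1) (x : ℝ)
    (hx : |x| ≤ 1 / 2) :
    1 + (l : ℂ) * (Complex.exp (Complex.I * x) - 1) ≠ 0 ∧
    ‖Complex.log (1 + (l : ℂ) * (Complex.exp (Complex.I * x) - 1)) -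
      (Complex.I * l * x - (l * (1 - l) : ℝ) / 2 * x ^ 2 +
        (-(Complex.I / 6) * (l * (1 - l) : ℝ) * (1 - 2 * l)) * x ^ 3 +
        (1 / 24 * (l * (1 - l) : ℝ) * (1 - 6 * (l * (1 - l) : ℝ))) * x ^ 4)‖ ≤
      260 * (l * (1 - l)) * |x| ^ 5 := by
  set D : ℝ → ℂ := fun x => 1 + (l : ℂ) * (Complex.exp (Complex.I * x) - 1) with hD
  set p : ℝ → ℂ := fun x => l * Complex.exp (Complex.I * x) / D x with hp
  have hD1 : ∀ x : ℝ, |x| ≤ 1 / 2 → ‖D x - 1‖ ≤ 1 / 2 := fun x hx => by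
    have := Real.norm_exp_I_mul_ofReal_sub_one_le (x := x)
    rw [Real.norm_eq_abs] at this
    simp only [hD, add_sub_cancel_left, norm_mul, Complex.norm_real, Real.norm_eq_abs,
      abs_of_nonneg h0]
    nlinarith [norm_nonneg (Complex.exp (Complex.I * x) - 1)]
  have hD2 : ∀ x : ℝ, |x| ≤ 1 / 2 → 1 / 2 ≤ ‖D x‖ := fun x hx => by
    have h := norm_sub_norm_le (1 : ℂ) (1 - D x)
    rw [norm_sub_rev 1 (D x), norm_one, sub_sub_cancel] at h
    linarith [hD1 x hx]
  have hD0 : ∀ x : ℝ, |x| ≤ 1 / 2 → D x ≠ 0 := fun x hx h => by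
    have := hD2 x hx
    rw [h, norm_zero] at this
    linarith
  have hDs : ∀ x : ℝ, |x| ≤ 1 / 2 → D x ∈ Complex.slitPlane := fun x hx => by
    have := Complex.mem_slitPlane_of_norm_lt_one ((hD1 x hx).trans_lt (by norm_num))
    simpa using this
  have hexp : ∀ x : ℝ, HasDerivAt (fun x : ℝ => Complex.exp (Complex.I * x))
      (Complex.exp (Complex.I * x) * Complex.I) x := fun x => by
    have := ((Complex.ofRealCLM.hasDerivAt (x := x)).const_mul Complex.I).cexp
    simpa using this
  have hDd : ∀ x : ℝ, HasDerivAt D (l * (Complex.exp (Complex.I * x) * Complex.I)) x :=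
    fun x => (((hexp x).sub_const 1).const_mul (l : ℂ)).const_add 1
  have hpd : ∀ x : ℝ, |x| ≤ 1 / 2 → HasDerivAt p (Complex.I * (p x * (1 - p x))) x :=
    fun x hx => by
      have h := ((hexp x).const_mul (l : ℂ)).div (hDd x) (hD0 x hx)
      refine h.congr_deriv ?_
      have := hD0 x hx
      simp only [hp]
      field_simp
  have hone : ∀ x : ℝ, |x| ≤ 1 / 2 → 1 - p x = (1 - l) / D x := fun x hx => by
    have := hD0 x hx
    simp only [hp]
    field_simp
    simp only [hD]
    ring
  have hpb : ∀ x : ℝ, |x| ≤ 1 / 2 → ‖p x‖ ≤ 2 * l := fun x hx => by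
    have := hD2 x hx
    simp only [hp, norm_div, norm_mul, Complex.norm_real, Complex.norm_exp_I_mul_ofReal,
      Real.norm_eq_abs, abs_of_nonneg h0]
    rw [div_le_iff₀ (by linarith)]
    nlinarith
  have hqb : ∀ x : ℝ, |x| ≤ 1 / 2 → ‖1 - p x‖ ≤ 2 * (1 - l) := fun x hx => by
    have := hD2 x hx
    have h : ‖(1 - l : ℂ)‖ = 1 - l := by
      rw [← Complex.ofReal_one, ← Complex.ofReal_sub, Complex.norm_real, Real.norm_eq_abs,
        abs_of_nonneg (by linarith)]
    rw [hone x hx, norm_div, h, div_le_iff₀ (by linarith)]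
    nlinarith
  have hpqb : ∀ x : ℝ, |x| ≤ 1 / 2 → ‖p x * (1 - p x)‖ ≤ 4 * (l * (1 - l)) := fun x hx => by
    rw [norm_mul]
    calc _ ≤ 2 * l * (2 * (1 - l)) := by
          gcongr
          exacts [hpb x hx, hqb x hx]
      _ = _ := by ring
  have hp0 : p 0 = l := by simp [hp, hD]
  have hmono : ∀ (n : ℕ) (a : ℂ) (x : ℝ),
      HasDerivAt (fun x : ℝ => a * (x : ℂ) ^ (n + 1)) (a * (n + 1) * (x : ℂ) ^ n) x :=
    fun n a x => by
      have h := ((Complex.ofRealCLM.hasDerivAt (x := x)).pow (n + 1)).const_mul a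
      refine h.congr_deriv ?_
      simp
      ring
  set Q : ℂ := l * (1 - l) with hQ
  have e4 := norm_le_mul_pow_succ_of_hasDerivAt (k := 0) (δ := 1 / 2) (K := 260 * (l * (1 - l)))
    (g := fun x => p x * (1 - p x) * (1 - 6 * (p x * (1 - p x))) - Q * (1 - 6 * Q))
    (g' := fun x => Complex.I * (p x * (1 - p x) * ((1 - 2 * p x) * (1 - 12 * (p x * (1 - p x))))))
    (fun x hx => by
      have h := hpd x hx
      have h2 := h.mul (h.const_sub 1)
      have h3 := (h2.mul ((h2.const_mul 6).const_sub 1)).sub_const (Q * (1 - 6 * Q))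
      refine h3.congr_deriv ?_
      simp
      ring)
    (by simp [hp0, hQ])
    (fun x hx => by
      have hΛ : l * (1 - l) ≤ 1 / 4 := by nlinarith [sq_nonneg (l - 1 / 2)]
      have hΛ0 : 0 ≤ l * (1 - l) := mul_nonneg h0 (by linarith)
      have h2 : ‖1 - 2 * p x‖ ≤ 5 := by
        refine (norm_sub_le _ _).trans ?_
        have := hpb x hx
        simp
        linarith
      have h3 : ‖1 - 12 * (p x * (1 - p x))‖ ≤ 13 := by
        refine (norm_sub_le _ _).trans ?_
        have := hpqb x hx
        rw [norm_mul]
        simp only [norm_one, Complex.norm_ofNat]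
        linarith
      rw [norm_mul, Complex.norm_I, norm_mul (p x * _), norm_mul (1 - 2 * p x), one_mul]
      calc _ ≤ 4 * (l * (1 - l)) * (5 * 13) := by
            gcongr
            exact hpqb x hx
        _ = _ := by ring)
  have e3 := norm_le_mul_pow_succ_of_hasDerivAt (k := 1) (δ := 1 / 2) (K := 260 * (l * (1 - l)))
    (g := fun x => -Complex.I * (p x * (1 - p x) * (1 - 2 * p x)) -
      (-Complex.I * (Q * (1 - 2 * l))) - Q * (1 - 6 * Q) * (x : ℂ) ^ 1)
    (fun x hx => by
      have h := hpd x hx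
      have h2 := h.mul (h.const_sub 1)
      have h3 := (((h2.mul ((h.const_mul 2).const_sub 1)).const_mul (-Complex.I)).sub_const
        (-Complex.I * (Q * (1 - 2 * l)))).sub (hmono 0 (Q * (1 - 6 * Q)) x)
      refine h3.congr_deriv ?_
      simp
      linear_combination (-p x * (1 - p x) * (1 - 6 * (p x * (1 - p x)))) * Complex.I_sq)
    (by simp [hp0, hQ])
    e4
  have e2 := norm_le_mul_pow_succ_of_hasDerivAt (k := 2) (δ := 1 / 2) (K := 260 * (l * (1 - l)))
    (g := fun x => -(p x * (1 - p x)) + Q - (-Complex.I * (Q * (1 - 2 * l))) * (x : ℂ) ^ 1 -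
      Q * (1 - 6 * Q) / 2 * (x : ℂ) ^ 2)
    (fun x hx => by
      have h := hpd x hx
      have h2 := h.mul (h.const_sub 1)
      have h3 := ((h2.neg.add_const Q).sub (hmono 0 (-Complex.I * (Q * (1 - 2 * l))) x)).sub
        (hmono 1 (Q * (1 - 6 * Q) / 2) x)
      refine h3.congr_deriv ?_
      simp
      ring)
    (by simp [hp0, hQ])
    e3
  have e1 := norm_le_mul_pow_succ_of_hasDerivAt (k := 3) (δ := 1 / 2) (K := 260 * (l * (1 - l)))
    (g := fun x => Complex.I * p x - Complex.I * l - (-Q) * (x : ℂ) ^ 1 -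
      (-Complex.I * (Q * (1 - 2 * l))) / 2 * (x : ℂ) ^ 2 - Q * (1 - 6 * Q) / 6 * (x : ℂ) ^ 3)
    (fun x hx => by
      have h := hpd x hx
      have h3 := ((((h.const_mul Complex.I).sub_const (Complex.I * l)).sub (hmono 0 (-Q) x)).sub
        (hmono 1 ((-Complex.I * (Q * (1 - 2 * l))) / 2) x)).sub
        (hmono 2 (Q * (1 - 6 * Q) / 6) x)
      refine h3.congr_deriv ?_
      simp
      linear_combination (p x * (1 - p x)) * Complex.I_sq)
    (by simp [hp0])
    e2
  have e0 := norm_le_mul_pow_succ_of_hasDerivAt (k := 4) (δ := 1 / 2) (K := 260 * (l * (1 - l)))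
    (g := fun x => Complex.log (D x) - Complex.I * l * (x : ℂ) ^ 1 - (-Q / 2) * (x : ℂ) ^ 2 -
      (-Complex.I * (Q * (1 - 2 * l))) / 6 * (x : ℂ) ^ 3 - Q * (1 - 6 * Q) / 24 * (x : ℂ) ^ 4)
    (fun x hx => by
      have h := (hDd x).clog_real (hDs x hx)
      have h3 := (((h.sub (hmono 0 (Complex.I * l) x)).sub (hmono 1 (-Q / 2) x)).sub
        (hmono 2 ((-Complex.I * (Q * (1 - 2 * l))) / 6) x)).sub
        (hmono 3 (Q * (1 - 6 * Q) / 24) x)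
      refine h3.congr_deriv ?_
      simp [hp]
      ring)
    (by simp [hD])
    e1 x hx
  refine ⟨hD0 x hx, ?_⟩
  convert e0 using 2
  simp only [hQ]
  push_cast
  ring

theorem sum_pi_apply {r m : ℕ} (g : Fin m → ℝ) (t : Fin r) :
    ∑ e : Fin r → Fin m, g (e t) = (m : ℝ) ^ (r - 1) * ∑ j, g j := by
  have h := Finset.prod_univ_sum (fun _ : Fin r => (Finset.univ : Finset (Fin m)))
    (Function.update (fun _ _ => (1 : ℝ)) t g)
  have hl : ∀ e : Fin r → Fin m,
      ∏ i, Function.update (fun _ _ => (1 : ℝ)) t g i (e i) = g (e t) := fun e => by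
    rw [Finset.prod_eq_single t] <;> simp +contextual [Function.update_of_ne]
  rw [Fintype.piFinset_univ] at h
  simp only [hl] at h
  rw [← h, ← Finset.mul_prod_erase _ _ (Finset.mem_univ t), mul_comm]
  congr 1
  · rw [Finset.prod_congr rfl (g := fun _ => (m : ℝ))]
    · simp [Finset.card_erase_of_mem]
    · intro i hi
      simp [Function.update_of_ne (Finset.ne_of_mem_erase hi)]
  · simp

theorem sum_pi_apply_mul_apply {r m : ℕ} (g h : Fin m → ℝ) {s t : Fin r} (hst : s ≠ t) :
    ∑ e : Fin r → Fin m, g (e s) * h (e t) =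
      (m : ℝ) ^ (r - 2) * ((∑ j, g j) * ∑ j, h j) := by
  have H := Finset.prod_univ_sum (fun _ : Fin r => (Finset.univ : Finset (Fin m)))
    (Function.update (Function.update (fun _ _ => (1 : ℝ)) t h) s g)
  have hl : ∀ e : Fin r → Fin m,
      ∏ i, Function.update (Function.update (fun _ _ => (1 : ℝ)) t h) s g i (e i) =
        g (e s) * h (e t) := fun e => by
    rw [Finset.prod_eq_mul s t hst] <;> simp +contextual [Function.update_of_ne, hst.symm]
  rw [Fintype.piFinset_univ] at H
  simp only [hl] at H
  have ht : t ∈ Finset.univ.erase s := by simp [hst.symm]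
  rw [← H, ← Finset.mul_prod_erase _ _ (Finset.mem_univ s), ← Finset.mul_prod_erase _ _ ht,
    ← mul_assoc, mul_comm]
  congr 1
  · rw [Finset.prod_congr rfl (g := fun _ => (m : ℝ))]
    · simp [Finset.card_erase_of_mem, ht, Nat.sub_sub]
    · intro i hi
      simp only [Finset.mem_erase] at hi
      simp [Function.update_of_ne hi.1, Function.update_of_ne hi.2.1]
  · simp [Function.update_of_ne hst.symm]

theorem sum_edgeSum (r m : ℕ) (θ : Fin r × Fin m → ℝ) :
    ∑ e : Fin r → Fin m, edgeSum r m θ e = (m : ℝ) ^ (r - 1) * ∑ p, θ p := by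
  simp only [edgeSum]
  rw [Finset.sum_comm, Fintype.sum_prod_type, Finset.mul_sum]
  exact Finset.sum_congr rfl fun t _ => sum_pi_apply (fun j => θ (t, j)) t

theorem sum_edgeSum_sq {r m : ℕ} (hr : 2 ≤ r) (hm : 1 ≤ m) (θ : Fin r × Fin m → ℝ) :
    ∑ e : Fin r → Fin m, edgeSum r m θ e ^ 2 = (m : ℝ) ^ (r - 1) *
      ((∑ p : Fin r × Fin m, θ p ^ 2) -
        (∑ t : Fin r, (∑ j : Fin m, θ (t, j)) ^ 2) / m +
        (∑ p : Fin r × Fin m, θ p) ^ 2 / m) := by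
  have hm0 : (m : ℝ) ≠ 0 := by positivity
  have hpow : (m : ℝ) ^ (r - 1) = (m : ℝ) ^ (r - 2) * m := by
    rw [← pow_succ]
    congr 1
    omega
  have hpair : ∀ s t : Fin r, ∑ e : Fin r → Fin m, θ (s, e s) * θ (t, e t) =
      (m : ℝ) ^ (r - 2) * ((∑ j, θ (s, j)) * ∑ j, θ (t, j)) +
        if s = t then (m : ℝ) ^ (r - 1) * ∑ j, θ (s, j) ^ 2 -
          (m : ℝ) ^ (r - 2) * (∑ j, θ (s, j)) ^ 2 else 0 := fun s t => by
    by_cases hst : s = t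
    · subst hst
      have h := sum_pi_apply (fun j => θ (s, j) ^ 2) s
      simp only [← pow_two, if_true]
      rw [h]
      ring
    · rw [if_neg hst, add_zero]
      exact sum_pi_apply_mul_apply (fun j => θ (s, j)) (fun j => θ (t, j)) hst
  have hexpand : ∑ e : Fin r → Fin m, edgeSum r m θ e ^ 2 =
      ∑ s, ∑ t, ∑ e : Fin r → Fin m, θ (s, e s) * θ (t, e t) := by
    simp only [edgeSum, pow_two, Finset.sum_mul_sum]
    rw [Finset.sum_comm]
    exact Finset.sum_congr rfl fun s _ => Finset.sum_comm
  rw [hexpand]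
  simp only [hpair, Finset.sum_add_distrib, Finset.sum_ite_eq, Finset.mem_univ, if_true,
    Finset.sum_sub_distrib, ← Finset.mul_sum]
  rw [← Finset.sum_mul, Fintype.sum_prod_type, Fintype.sum_prod_type, hpow]
  field_simp
  ring

/-- Up to the summed per-edge errors, `F` is the exponential of its fourth-order expansion
wherever all the edge sums are small. -/
theorem exists_Ffun_eq_exp {r m d : ℕ} (hr : 2 ≤ r) (hm : 1 ≤ m) (h0 : 0 ≤ lam r m d)
    (h1 : lam r m d ≤ 1) {θ : Fin r × Fin m → ℝ} {y : ℝ} (hy : y ≤ 1 / 2)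
    (hθ : ∀ e, |edgeSum r m θ e| ≤ y) :
    ∃ E : ℂ, ‖E‖ ≤ (m : ℝ) ^ r * (260 * Lam r m d * y ^ 5) ∧
        Ffun r m d θ = Complex.exp (
          -((qA r m d θ : ℝ) : ℂ) +
          (-(Complex.I / 6) * (Lam r m d : ℂ) * (1 - 2 * (lam r m d : ℂ))) *
            ∑ e : Fin r → Fin m, ((edgeSum r m θ e : ℝ) : ℂ) ^ 3 +
          ((1 : ℂ) / 24 * (Lam r m d : ℂ) * (1 - 6 * (Lam r m d : ℂ))) *
            ∑ e : Fin r → Fin m, ((edgeSum r m θ e : ℝ) : ℂ) ^ 4 + E) := by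
  have hloc := fun e => norm_log_bernoulli_charFun_sub_le h0 h1 (edgeSum r m θ e)
    ((hθ e).trans hy)
  have hΛ : 0 ≤ Lam r m d := mul_nonneg h0 (by linarith)
  refine ⟨∑ e, _, (norm_sum_le_of_le Finset.univ fun e _ => (hloc e).2).trans ?_, ?_⟩
  · calc _ ≤ ∑ e : Fin r → Fin m, 260 * Lam r m d * y ^ 5 := by
          refine Finset.sum_le_sum fun e _ => mul_le_mul_of_nonneg_left
            (pow_le_pow_left₀ (abs_nonneg _) (hθ e) 5) ?_
          exact mul_nonneg (by norm_num) hΛ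
      _ = _ := by simp
  · have hprod : ∏ e : Fin r → Fin m,
        (1 + (lam r m d : ℂ) * (Complex.exp (Complex.I * (edgeSum r m θ e : ℂ)) - 1)) =
        Complex.exp (∑ e : Fin r → Fin m, Complex.log
          (1 + (lam r m d : ℂ) * (Complex.exp (Complex.I * (edgeSum r m θ e : ℂ)) - 1))) := by
      rw [Complex.exp_sum]
      exact Finset.prod_congr rfl fun e _ => (Complex.exp_log (hloc e).1).symm
    have hm0 : (m : ℂ) ≠ 0 := by
      exact_mod_cast (by omega : m ≠ 0)
    have hlam : (lam r m d : ℂ) * (m : ℂ) ^ (r - 1) = d := by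
      simp only [lam]
      push_cast
      field_simp
    have hone : ∑ e : Fin r → Fin m, (edgeSum r m θ e : ℂ) =
        (m : ℂ) ^ (r - 1) * ((∑ p, θ p : ℝ) : ℂ) := by
      exact_mod_cast congrArg (fun x : ℝ => (x : ℂ)) (sum_edgeSum r m θ)
    have htwo : ((Lam r m d : ℝ) : ℂ) / 2 * ∑ e : Fin r → Fin m, (edgeSum r m θ e : ℂ) ^ 2 =
        ((qA r m d θ : ℝ) : ℂ) := by
      have h : Lam r m d / 2 * ∑ e : Fin r → Fin m, edgeSum r m θ e ^ 2 = qA r m d θ := by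
        rw [sum_edgeSum_sq hr hm, qA]
        ring
      exact_mod_cast congrArg (fun x : ℝ => (x : ℂ)) h
    have hLam : lam r m d * (1 - lam r m d) = Lam r m d := rfl
    rw [Ffun, hprod, ← Complex.exp_add]
    congr 1
    simp only [Finset.sum_sub_distrib, Finset.sum_add_distrib, ← Finset.mul_sum, hLam, hone, htwo]
    linear_combination (Complex.I * ((∑ p, θ p : ℝ) : ℂ)) * hlam

theorem abs_edgeSum_le {r m : ℕ} {θ : Fin r × Fin m → ℝ} {ρ : ℝ} (hθ : ∀ p, |θ p| ≤ ρ)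
    (e : Fin r → Fin m) : |edgeSum r m θ e| ≤ r * ρ := by
  refine (Finset.abs_sum_le_sum_abs _ _).trans ?_
  simpa using Finset.sum_le_sum (s := Finset.univ) fun t (_ : t ∈ Finset.univ) => hθ (t, e t)

theorem mul_rho0_eq (r m d : ℕ) : (r : ℝ) * rho0 r m d =
    √r ^ 7 * Real.log ((r : ℝ) * m) / √(Lam r m d * (m : ℝ) ^ (r - 1)) := by
  have hr : (r : ℝ) ^ ((5 : ℝ) / 2) = √r ^ 5 := by
    rw [Real.sqrt_eq_rpow, ← Real.rpow_natCast, ← Real.rpow_mul (by positivity)]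
    norm_num
  have h2 : (r : ℝ) = √r ^ 2 := (Real.sq_sqrt (by positivity)).symm
  rw [rho0, hr]
  nth_rewrite 1 [h2]
  ring

theorem le_sqrt_Lam_mul_pow {c : ℝ} (hc : 0 < c) {r m d : ℕ} (hr : 1 ≤ r) (hm : 1 ≤ m)
    (h : c * (r : ℝ) ^ 16 * (m : ℝ) ^ ((2 : ℤ) - (r : ℤ)) ≤ Lam r m d) :
    √c * √r ^ 16 * √m ≤ √(Lam r m d * (m : ℝ) ^ (r - 1)) := by
  have hm0 : (0 : ℝ) < m := by positivity
  have hz : (m : ℝ) ^ ((2 : ℤ) - (r : ℤ)) * (m : ℝ) ^ (r - 1) = m := by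
    rw [← zpow_natCast, ← zpow_add₀ hm0.ne', Nat.cast_sub hr]
    convert zpow_one (m : ℝ) using 2
    push_cast
    ring
  have hr2 : √(r : ℝ) ^ 2 = r := Real.sq_sqrt (by positivity)
  refine Real.le_sqrt_of_sq_le ?_
  calc (√c * √r ^ 16 * √m) ^ 2 = √c ^ 2 * (√r ^ 2) ^ 16 * √m ^ 2 := by ring
    _ = c * (r : ℝ) ^ 16 * m := by
        rw [hr2, Real.sq_sqrt hc.le, Real.sq_sqrt hm0.le]
    _ = c * (r : ℝ) ^ 16 * (m : ℝ) ^ ((2 : ℤ) - (r : ℤ)) * (m : ℝ) ^ (r - 1) := by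
        rw [mul_assoc (c * (r : ℝ) ^ 16), hz]
    _ ≤ _ := by gcongr

/-- Taylor expansion of `log F` near the origin: for all `c, c' > 0` there
are `C > 0` and `N` such that whenever `n = rm ≥ N`, `r ≥ 3`, `1 ≤ d ≤ m^{r−1} − 1`,
`Λ ≥ c·r^16·m^{2−r}` and `‖θ‖_∞ ≤ c'·ρ₀`, there is `E` with `|E| ≤ C n^{−1/2} log⁵ n` and
`F(θ) = exp(−θᵗAθ + Σ_{p=3}^4 a_p(λ) Σ_e (Σ_{j∈e} θ_j)^p + E)`,
with `a₃(λ) = −(i/6)Λ(1−2λ)` and `a₄(λ) = (1/24)Λ(1−6Λ)`. -/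
theorem taylor_expansion_of_F (c c' : ℝ) (hc : 0 < c) (hc' : 0 < c') :
    ∃ C : ℝ, 0 < C ∧ ∃ N : ℕ, ∀ r m d : ℕ, 3 ≤ r → 1 ≤ m → N ≤ r * m →
      1 ≤ d → d ≤ m ^ (r - 1) - 1 →
      c * (r : ℝ) ^ 16 * (m : ℝ) ^ ((2 : ℤ) - (r : ℤ)) ≤ Lam r m d →
      ∀ θ : Fin r × Fin m → ℝ, (∀ p, |θ p| ≤ c' * rho0 r m d) →
      ∃ E : ℂ,
        ‖E‖ ≤ C * ((r * m : ℕ) : ℝ) ^ (-(1 : ℝ) / 2) * Real.log ((r : ℝ) * m) ^ 5 ∧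
        Ffun r m d θ = Complex.exp (
          -((qA r m d θ : ℝ) : ℂ) +
          (-(Complex.I / 6) * (Lam r m d : ℂ) * (1 - 2 * (lam r m d : ℂ))) *
            ∑ e : Fin r → Fin m, ((edgeSum r m θ e : ℝ) : ℂ) ^ 3 +
          ((1 : ℂ) / 24 * (Lam r m d : ℂ) * (1 - 6 * (Lam r m d : ℂ))) *
            ∑ e : Fin r → Fin m, ((edgeSum r m θ e : ℝ) : ℂ) ^ 4 + E) := by
  set K : ℝ := c' / √c with hK
  have hk : 0 < √c := Real.sqrt_pos.2 hc
  have hKpos : 0 < K := div_pos hc' hk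
  have hlim : Tendsto (fun n : ℕ => Real.log n / √(n : ℝ)) atTop (nhds 0) := by
    have h := (isLittleO_log_rpow_atTop (r := 1 / 2) (by norm_num)).tendsto_div_nhds_zero
    simp only [← Real.sqrt_eq_rpow] at h
    exact h.comp tendsto_natCast_atTop_atTop
  obtain ⟨N, hN⟩ := eventually_atTop.1
    (hlim.eventually (eventually_le_nhds (show (0 : ℝ) < 1 / (2 * K) by positivity)))
  refine ⟨260 * c' ^ 5 / √c ^ 3, by positivity, N, ?_⟩
  intro r m d hr hm hn hd hd' hΛ θ hθ
  have hm0 : (0 : ℝ) < m := by positivity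
  have hr1 : (1 : ℝ) ≤ r := by exact_mod_cast (by omega : 1 ≤ r)
  have hm1 : (1 : ℝ) ≤ m := by exact_mod_cast hm
  have hl0 : 0 ≤ lam r m d := by
    unfold lam
    positivity
  have hl1 : lam r m d ≤ 1 := by
    refine div_le_one_of_le₀ ?_ (by positivity)
    exact_mod_cast hd'.trans (Nat.sub_le _ _)
  set L := Real.log ((r : ℝ) * m) with hL
  have hL0 : 0 ≤ L := Real.log_nonneg (one_le_mul_of_one_le_of_one_le hr1 hm1)
  have hR : 1 ≤ √(r : ℝ) := Real.one_le_sqrt.2 hr1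
  have hμ : 0 < √(m : ℝ) := Real.sqrt_pos.2 hm0
  have hs := le_sqrt_Lam_mul_pow hc (by omega) hm hΛ
  have hρ := mul_rho0_eq r m d
  have hsq : √(Lam r m d * (m : ℝ) ^ (r - 1)) ^ 2 = Lam r m d * (m : ℝ) ^ (r - 1) :=
    Real.sq_sqrt (mul_nonneg (mul_nonneg hl0 (by linarith)) (by positivity))
  set s := √(Lam r m d * (m : ℝ) ^ (r - 1))
  have hs0 : 0 < s := lt_of_lt_of_le (by positivity) hs
  have hsqrt : √((r * m : ℕ) : ℝ) = √r * √m := by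
    push_cast
    exact Real.sqrt_mul (by positivity) _
  have hy : c' * (√r ^ 7 * L / s) ≤ 1 / 2 := by
    have hNn := hN _ hn
    rw [hsqrt, Nat.cast_mul, ← hL] at hNn
    calc c' * (√r ^ 7 * L / s) ≤ c' * (√r ^ 8 * L / (√c * √r ^ 9 * √m)) := by
          gcongr
          · norm_num
          · refine le_trans ?_ hs
            gcongr
            norm_num
      _ = K * (L / (√r * √m)) := by
          rw [hK]
          field_simp
      _ ≤ K * (1 / (2 * K)) := by gcongr
      _ = 1 / 2 := by field_simp
  obtain ⟨E, hE, hF⟩ := exists_Ffun_eq_exp (by omega) hm hl0 hl1 hy fun e => by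
    have h := abs_edgeSum_le hθ e
    rwa [mul_left_comm, hρ] at h
  refine ⟨E, hE.trans ?_, hF⟩
  have hpow : (m : ℝ) ^ r = m * (m : ℝ) ^ (r - 1) := by
    rw [← pow_succ']
    congr 1
    omega
  have hn' : ((r * m : ℕ) : ℝ) ^ (-(1 : ℝ) / 2) = 1 / (√r * √m) := by
    rw [neg_div, Real.rpow_neg (by positivity), ← Real.sqrt_eq_rpow, hsqrt, one_div]
  rw [hn']
  calc (m : ℝ) ^ r * (260 * Lam r m d * (c' * (√r ^ 7 * L / s)) ^ 5)
      = 260 * m * s ^ 2 * (c' * (√r ^ 7 * L / s)) ^ 5 := by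
        rw [hsq, hpow]
        ring
    _ = 260 * c' ^ 5 * √m ^ 2 * √r ^ 35 * L ^ 5 / s ^ 3 := by
        rw [Real.sq_sqrt hm0.le]
        field_simp
    _ ≤ 260 * c' ^ 5 * √m ^ 2 * √r ^ 47 * L ^ 5 / (√c * √r ^ 16 * √m) ^ 3 := by
        gcongr
        norm_num
    _ = 260 * c' ^ 5 / √c ^ 3 * (1 / (√r * √m)) * L ^ 5 := by
        field_simp
end

section
/- Let r ≥ 2, m ≥ 1 be integers, n = rm, and let λ ∈ (0,1) with Λ = λ(1−λ). With A = (Λ m^{r−1}/2)(I_n − B/m + J_n/m), W = (Λ m^{r−3}/(2r))^{1/2}(rB − J_n), and T = (2/(Λ m^{r−1}))^{1/2}(I_n − ((√r − 1)/(√r·m))B), the following hold: (a) A + WᵗW has eigenvalue Λ r m^{r−1}/2 with multiplicity r and eigenvalue Λ m^{r−1}/2 with multiplicity n − r; (b) det(A + WᵗW) = (Λ m^{r−1}/2)^n · r^r; (c) Tᵗ(A + WᵗW)T = I_n; (d) (A + WᵗW)^{−1} = (2/(Λ m^{r−1}))·(I_n − ((r−1)/n)·B); (e) the induced ∞-norm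 and 1-norm of T are equal and at most 3/(Λ m^{r−1})^{1/2}; (f) the induced ∞-norm of T^{−1} equals 2^{−1/2}·(Λ r m^{r−1})^{1/2}. -/
open Matrix Polynomial

/-- The block-diagonal matrix `B` with `r` diagonal blocks `J_m`, the blocks corresponding
to the classes (vertices indexed by `Fin r × Fin m`, class = first coordinate). -/
def Bmat (r m : ℕ) : Matrix (Fin r × Fin m) (Fin r × Fin m) ℝ :=
  Matrix.of fun p q => if p.1 = q.1 then 1 else 0

/-- The all-ones matrix `J_n`. -/
def Jmat (r m : ℕ) : Matrix (Fin r × Fin m) (Fin r × Fin m) ℝ :=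
  Matrix.of fun _ _ => 1

/-- `A = (Λ m^{r−1}/2)(I_n − B/m + J_n/m)`. -/
noncomputable def Amat (r m : ℕ) (Λ : ℝ) : Matrix (Fin r × Fin m) (Fin r × Fin m) ℝ :=
  (Λ * (m : ℝ) ^ ((r : ℤ) - 1) / 2) • (1 - (m : ℝ)⁻¹ • Bmat r m + (m : ℝ)⁻¹ • Jmat r m)

/-- `W = (Λ m^{r−3}/(2r))^{1/2} (rB − J_n)`. -/
noncomputable def Wmat (r m : ℕ) (Λ : ℝ) : Matrix (Fin r × Fin m) (Fin r × Fin m) ℝ :=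
  Real.sqrt (Λ * (m : ℝ) ^ ((r : ℤ) - 3) / (2 * r)) • ((r : ℝ) • Bmat r m - Jmat r m)

/-- `T = (2/(Λ m^{r−1}))^{1/2} (I_n − ((√r − 1)/(√r·m)) B)`. -/
noncomputable def Tmat (r m : ℕ) (Λ : ℝ) : Matrix (Fin r × Fin m) (Fin r × Fin m) ℝ :=
  Real.sqrt (2 / (Λ * (m : ℝ) ^ ((r : ℤ) - 1))) •
    (1 - ((Real.sqrt r - 1) / (Real.sqrt r * m)) • Bmat r m)

/-- The operator norm induced by the `ℓ_∞` vector norm: maximum absolute row sum. -/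
noncomputable def rowNorm {n : Type*} [Fintype n] (M : Matrix n n ℝ) : ℝ :=
  ⨆ i, ∑ j, |M i j|

/-- The operator norm induced by the `ℓ_1` vector norm: maximum absolute column sum. -/
noncomputable def colNorm {n : Type*} [Fintype n] (M : Matrix n n ℝ) : ℝ :=
  ⨆ j, ∑ i, |M i j|

/-- The class indicator matrix. -/
def classIndicator (r m : ℕ) : Matrix (Fin r × Fin m) (Fin r) ℝ :=
  Matrix.of fun p i => if p.1 = i then 1 else 0

theorem classIndicator_mul_transpose (r m : ℕ) :
    classIndicator r m * (classIndicator r m)ᵀ = Bmat r m := by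
  ext p q
  simp [classIndicator, Bmat, Matrix.mul_apply, eq_comm]

theorem transpose_mul_classIndicator (r m : ℕ) :
    (classIndicator r m)ᵀ * classIndicator r m = (m : ℝ) • 1 := by
  ext i j
  obtain rfl | h := eq_or_ne i j
  · simp [classIndicator, Matrix.mul_apply, Fintype.sum_prod_type_right]
  · simp [classIndicator, Matrix.mul_apply, Fintype.sum_prod_type_right, h, h.symm]

theorem Bmat_transpose (r m : ℕ) : (Bmat r m)ᵀ = Bmat r m := by
  ext p q
  simp [Bmat, eq_comm]

theorem Jmat_transpose (r m : ℕ) : (Jmat r m)ᵀ = Jmat r m := by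
  ext p q
  simp [Jmat]

theorem Bmat_mul_Bmat (r m : ℕ) : Bmat r m * Bmat r m = (m : ℝ) • Bmat r m := by
  ext p q
  by_cases h : p.1 = q.1 <;> simp [Bmat, Matrix.mul_apply, Fintype.sum_prod_type_right, h]

theorem Bmat_mul_Jmat (r m : ℕ) : Bmat r m * Jmat r m = (m : ℝ) • Jmat r m := by
  ext p q
  simp [Bmat, Jmat, Matrix.mul_apply, Fintype.sum_prod_type_right, -Finset.sum_boole]

theorem Jmat_mul_Bmat (r m : ℕ) : Jmat r m * Bmat r m = (m : ℝ) • Jmat r m := by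
  ext p q
  simp [Bmat, Jmat, Matrix.mul_apply, Fintype.sum_prod_type_right, -Finset.sum_boole]

theorem Jmat_mul_Jmat (r m : ℕ) : Jmat r m * Jmat r m = ((r : ℝ) * m) • Jmat r m := by
  ext p q
  simp [Jmat, Matrix.mul_apply]

theorem smul_one_add_smul_Bmat_mul (r m : ℕ) (a b c d : ℝ) :
    (a • (1 + b • Bmat r m)) * (c • (1 + d • Bmat r m)) =
      (a * c) • (1 + (b + d + b * d * m) • Bmat r m) := by
  simp only [Matrix.smul_mul, Matrix.mul_smul, Matrix.add_mul, Matrix.mul_add, Bmat_mul_Bmat,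
    Matrix.one_mul, Matrix.mul_one]
  module

theorem Amat_add_transpose_Wmat_mul_Wmat (r m : ℕ) (hr : r ≠ 0) (hm : m ≠ 0) (Λ : ℝ)
    (hΛ : 0 ≤ Λ) :
    Amat r m Λ + (Wmat r m Λ)ᵀ * Wmat r m Λ =
      (Λ * (m : ℝ) ^ ((r : ℤ) - 1) / 2) • (1 + (((r : ℝ) - 1) / m) • Bmat r m) := by
  have hm' : (m : ℝ) ≠ 0 := by exact_mod_cast hm
  have hr' : (r : ℝ) ≠ 0 := by exact_mod_cast hr
  have hpow : (m : ℝ) ^ ((r : ℤ) - 1) = (m : ℝ) ^ ((r : ℤ) - 3) * m ^ 2 := by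
    rw [← zpow_natCast, ← zpow_add₀ hm']
    congr 1
    push_cast
    ring
  have hW : (Wmat r m Λ)ᵀ * Wmat r m Λ =
      (Λ * (m : ℝ) ^ ((r : ℤ) - 3) * m / 2) • ((r : ℝ) • Bmat r m - Jmat r m) := by
    have hs : √(Λ * (m : ℝ) ^ ((r : ℤ) - 3) / (2 * r)) *
        √(Λ * (m : ℝ) ^ ((r : ℤ) - 3) / (2 * r)) = Λ * (m : ℝ) ^ ((r : ℤ) - 3) / (2 * r) :=
      Real.mul_self_sqrt (by positivity)
    simp only [Wmat, Matrix.transpose_smul, Matrix.transpose_sub, Bmat_transpose, Jmat_transpose,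
      Matrix.smul_mul, Matrix.mul_smul, Matrix.sub_mul, Matrix.mul_sub, Bmat_mul_Bmat,
      Bmat_mul_Jmat, Jmat_mul_Bmat, Jmat_mul_Jmat]
    generalize √(Λ * (m : ℝ) ^ ((r : ℤ) - 3) / (2 * r)) = s at hs ⊢
    have hs' : Λ * (m : ℝ) ^ ((r : ℤ) - 3) = s * s * (2 * r) := by
      rw [hs]
      field_simp
    rw [hs']
    module
  rw [hW, Amat, hpow]
  match_scalars <;> field_simp <;> ring

theorem charpoly_smul_one_add_smul_Bmat (r m : ℕ) (hm : 1 ≤ m) (a b : ℝ) :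
    (a • (1 + b • Bmat r m)).charpoly =
      (X - C (a * (1 + b * m))) ^ r * (X - C a) ^ (r * m - r) := by
  have hM : a • (1 + b • Bmat r m) =
      ((a * b) • classIndicator r m) * (classIndicator r m)ᵀ - Matrix.scalar _ (-a) := by
    rw [Matrix.smul_mul, classIndicator_mul_transpose, map_neg, sub_neg_eq_add,
      Matrix.scalar_apply, ← Matrix.smul_one_eq_diagonal]
    module
  have hN : (classIndicator r m)ᵀ * ((a * b) • classIndicator r m) =
      Matrix.diagonal fun _ => a * b * m := by
    rw [Matrix.mul_smul, transpose_mul_classIndicator, smul_smul, Matrix.smul_one_eq_diagonal]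
  rw [hM, Matrix.charpoly_sub_scalar, Matrix.charpoly_mul_comm_of_le _ _
    (by simpa using Nat.le_mul_of_pos_right r hm), hN, Matrix.charpoly_diagonal]
  simp only [Finset.prod_const, Finset.card_univ, Fintype.card_prod, Fintype.card_fin, mul_comp,
    pow_comp, sub_comp, X_comp, C_comp]
  rw [mul_comm]
  congr 2 <;> simp only [map_neg, map_mul, map_add, map_one] <;> ring

theorem rowNorm_smul_one_add_smul_Bmat (r m : ℕ) (hr : r ≠ 0) (hm : 1 ≤ m) (a b : ℝ) :
    rowNorm (a • (1 + b • Bmat r m)) = |a| * (|1 + b| + (m - 1) * |b|) := by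
  have hrow (p : Fin r × Fin m) :
      ∑ q, |(a • (1 + b • Bmat r m)) p q| = |a| * (|1 + b| + (m - 1) * |b|) := by
    have hterm (q : Fin r × Fin m) : |(a • (1 + b • Bmat r m)) p q| =
        (if p = q then |a| * (|1 + b| - |b|) else 0) + (if p.1 = q.1 then |a| * |b| else 0) := by
      by_cases h : p = q
      · subst h
        simp [Bmat, abs_mul]
        ring
      · by_cases h1 : p.1 = q.1 <;> simp [Bmat, h, h1, abs_mul]
    simp only [hterm, Finset.sum_add_distrib]
    rw [Fintype.sum_ite_eq, Fintype.sum_prod_type_right]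
    simp only [Fintype.sum_ite_eq, Finset.sum_const, Finset.card_univ, Fintype.card_fin,
      nsmul_eq_mul]
    ring
  have : Nonempty (Fin r × Fin m) := ⟨⟨0, by omega⟩, ⟨0, by omega⟩⟩
  simp only [rowNorm, hrow, ciSup_const]

theorem colNorm_eq_rowNorm_transpose {n : Type*} [Fintype n] (M : Matrix n n ℝ) :
    colNorm M = rowNorm Mᵀ := rfl

/-- identities and bounds for the matrices `A`, `W`, `T`:
(a) eigenvalues of `A + WᵗW` (as algebraic multiplicities in the characteristic
polynomial) are `Λrm^{r−1}/2` with multiplicity `r` and `Λm^{r−1}/2` with multiplicity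
`n − r`; (b) `det(A + WᵗW) = (Λm^{r−1}/2)^n r^r`; (c) `Tᵗ(A + WᵗW)T = I`;
(d) `(A + WᵗW)⁻¹ = (2/(Λm^{r−1}))(I − ((r−1)/n) B)`; (e) `‖T‖_∞ = ‖T‖_1 ≤
3/(Λm^{r−1})^{1/2}`; (f) `‖T⁻¹‖_∞ = 2^{−1/2}(Λrm^{r−1})^{1/2}`. -/
theorem linear_algebra_lemma (r m : ℕ) (hr : 2 ≤ r) (hm : 1 ≤ m)
    (lam Λ : ℝ) (hlam : lam ∈ Set.Ioo (0 : ℝ) 1) (hΛ : Λ = lam * (1 - lam)) :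
    (Amat r m Λ + (Wmat r m Λ)ᵀ * Wmat r m Λ).charpoly =
        (X - C (Λ * r * (m : ℝ) ^ ((r : ℤ) - 1) / 2)) ^ r *
          (X - C (Λ * (m : ℝ) ^ ((r : ℤ) - 1) / 2)) ^ (r * m - r) ∧
    (Amat r m Λ + (Wmat r m Λ)ᵀ * Wmat r m Λ).det =
        (Λ * (m : ℝ) ^ ((r : ℤ) - 1) / 2) ^ (r * m) * (r : ℝ) ^ r ∧
    (Tmat r m Λ)ᵀ * (Amat r m Λ + (Wmat r m Λ)ᵀ * Wmat r m Λ) * Tmat r m Λ = 1 ∧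
    (Amat r m Λ + (Wmat r m Λ)ᵀ * Wmat r m Λ)⁻¹ =
        (2 / (Λ * (m : ℝ) ^ ((r : ℤ) - 1))) •
          (1 - (((r : ℝ) - 1) / ((r : ℝ) * m)) • Bmat r m) ∧
    rowNorm (Tmat r m Λ) = colNorm (Tmat r m Λ) ∧
    rowNorm (Tmat r m Λ) ≤ 3 / Real.sqrt (Λ * (m : ℝ) ^ ((r : ℤ) - 1)) ∧
    rowNorm (Tmat r m Λ)⁻¹ =
        Real.sqrt (Λ * r * (m : ℝ) ^ ((r : ℤ) - 1)) / Real.sqrt 2 := by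
  have hm0 : (0 : ℝ) < m := by exact_mod_cast hm
  have hr1 : (1 : ℝ) < r := by exact_mod_cast hr
  have hΛ0 : 0 < Λ := hΛ ▸ mul_pos hlam.1 (sub_pos.2 hlam.2)
  have hK : 0 < Λ * (m : ℝ) ^ ((r : ℤ) - 1) := by positivity
  have hKr : Λ * r * (m : ℝ) ^ ((r : ℤ) - 1) = Λ * (m : ℝ) ^ ((r : ℤ) - 1) * r := by ring
  have hT : Tmat r m Λ = √(2 / (Λ * (m : ℝ) ^ ((r : ℤ) - 1))) •
      (1 + (-((√r - 1) / (√r * m))) • Bmat r m) := by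
    rw [Tmat, neg_smul, ← sub_eq_add_neg]
  have hTt : (Tmat r m Λ)ᵀ = Tmat r m Λ := by
    simp [Tmat, Bmat_transpose]
  rw [Amat_add_transpose_Wmat_mul_Wmat r m (by omega) (by omega) Λ hΛ0.le, hKr]
  have hcp := charpoly_smul_one_add_smul_Bmat r m hm (Λ * (m : ℝ) ^ ((r : ℤ) - 1) / 2)
    (((r : ℝ) - 1) / m)
  generalize Λ * (m : ℝ) ^ ((r : ℤ) - 1) = K at *
  have hs : 1 < √(r : ℝ) := Real.lt_sqrt_of_sq_lt (by simpa using hr1)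
  have hu : 0 < √(K / 2) := by positivity
  have huK : √(K / 2) ^ 2 = K / 2 := Real.sq_sqrt (by positivity)
  have hsqrtK : √K = √2 * √(K / 2) := by
    rw [← Real.sqrt_mul (by norm_num)]
    congr 1
    ring
  have hinvu : √(2 / K) = (√(K / 2))⁻¹ := by rw [← Real.sqrt_inv, inv_div]
  have hnorm : √(K * r) / √2 = √(K / 2) * √r := by
    rw [← Real.sqrt_div' _ (by norm_num), ← Real.sqrt_mul (by positivity)]
    congr 1
    ring
  have hsq : (r : ℝ) = √(r : ℝ) ^ 2 := (Real.sq_sqrt (by positivity)).symm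
  rw [hinvu] at hT
  rw [hnorm, hsqrtK]
  generalize √(r : ℝ) = s at *
  generalize √(K / 2) = u at *
  obtain rfl : K = 2 * u ^ 2 := by linarith
  have hinv : (2 * u ^ 2 / 2) • (1 + (((r : ℝ) - 1) / m) • Bmat r m) *
      ((2 / (2 * u ^ 2)) • (1 - (((r : ℝ) - 1) / (r * m)) • Bmat r m)) = 1 := by
    rw [sub_eq_add_neg 1, ← neg_smul, smul_one_add_smul_Bmat_mul]
    match_scalars <;> field_simp <;> ring
  have hTinv : Tmat r m Λ * (u • (1 + ((s - 1) / m) • Bmat r m)) = 1 := by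
    rw [hT, smul_one_add_smul_Bmat_mul]
    match_scalars <;> field_simp <;> ring
  refine ⟨?_, ?_, ?_, Matrix.inv_eq_right_inv hinv, ?_, ?_, ?_⟩
  · rw [hcp]
    congr 4
    field_simp
    ring
  · obtain ⟨k, hk⟩ := Nat.exists_eq_add_of_le (Nat.le_mul_of_pos_right r hm)
    rw [Matrix.det_eq_sign_charpoly_coeff, hcp, coeff_zero_eq_eval_zero, Fintype.card_prod,
      Fintype.card_fin, Fintype.card_fin, hk, Nat.add_sub_cancel_left]
    simp only [eval_mul, eval_pow, eval_sub, eval_X, eval_C, zero_sub]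
    rw [div_mul_cancel₀ _ hm0.ne', add_sub_cancel, neg_pow (_ * _), neg_pow (_ / _)]
    have hsign : ((-1 : ℝ) ^ (r + k)) * ((-1) ^ (r + k)) = 1 := by
      rw [← mul_pow]
      simp
    rw [mul_pow, pow_add (_ / _)]
    linear_combination (2 * u ^ 2 / 2) ^ r * (2 * u ^ 2 / 2) ^ k * (r : ℝ) ^ r * hsign
  · rw [hTt, hT, smul_one_add_smul_Bmat_mul, smul_one_add_smul_Bmat_mul, hsq]
    match_scalars <;> field_simp <;> ring
  · rw [colNorm_eq_rowNorm_transpose, hTt]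
  · rw [hT, rowNorm_smul_one_add_smul_Bmat r m (by omega) hm]
    have hm1 : (1 : ℝ) ≤ m := by exact_mod_cast hm
    have hβ0 : 0 ≤ (s - 1) / (s * m) := div_nonneg (by linarith) (by positivity)
    have hβm : (s - 1) / (s * m) * m ≤ 1 := by
      rw [div_mul_eq_mul_div, div_le_one (by positivity)]
      nlinarith
    generalize (s - 1) / (s * m) = β at *
    have hβ1 : β ≤ 1 := by nlinarith
    rw [abs_neg, abs_of_nonneg hβ0, abs_of_nonneg (show 0 ≤ 1 + -β by linarith),
      abs_of_pos (inv_pos.2 hu)]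
    have h2 : √2 ≤ 3 / 2 := Real.sqrt_le_iff.2 (by norm_num)
    have h2' : 0 < √(2 : ℝ) := by positivity
    rw [inv_mul_eq_div, ← div_div, div_le_div_iff_of_pos_right hu, le_div_iff₀ h2']
    nlinarith
  · rw [Matrix.inv_eq_right_inv hTinv, rowNorm_smul_one_add_smul_Bmat r m (by omega) hm]
    have hγ : 0 ≤ (s - 1) / m := div_nonneg (by linarith) hm0.le
    rw [abs_of_pos hu, abs_of_nonneg hγ, abs_of_nonneg (by linarith)]
    field_simp
    ring
end

section
/- Let r ≥ 2, m ≥ 1 be integers, n = rm, and let λ ∈ (0,1) with Λ = λ(1−λ). Let W = (Λ m^{r−3}/(2r))^{1/2}(rB − J_n), and let Q = I_n − Σ_{j=2}^{r} v_j·e_{jm}ᵗ, where e_ℓ ∈ ℝ^n is the ℓ-th standard basis vector and v_j = Σ_{ℓ ∈ V_j} e_ℓ − Σ_{ℓ ∈ V_1} e_ℓ for 2 ≤ j ≤ r. Then det(QᵗQ + WᵗW) = r^r · (Λ m^r / 2)^{r−1}. -/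
open Matrix

/-- `Q = I_n − Σ_{j=2}^r v_j e_{jm}ᵗ`, where `v_j` is the indicator vector of class `j`
minus the indicator vector of class `1`, and `e_{jm}` is the standard basis vector of the
last vertex of class `j`. -/
def Qmat (r m : ℕ) : Matrix (Fin r × Fin m) (Fin r × Fin m) ℝ :=
  Matrix.of fun p q =>
    (if p = q then (1 : ℝ) else 0) -
      (if q.1.val ≠ 0 ∧ q.2.val = m - 1 then
        (if p.1 = q.1 then (1 : ℝ) else 0) - (if p.1.val = 0 then (1 : ℝ) else 0)
      else 0)

section Determinants

variable {R n k : Type*} [CommRing R] [Fintype n] [DecidableEq n] [Fintype k] [DecidableEq k]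

/-- The Gram matrix `(1 - V Eᵀ)(1 - V Eᵀ)ᵀ` of an oblique projection, completed by an arbitrary
form on the span of `E`. -/
lemma det_oblique_mul_transpose_add (V E : Matrix n k R) (K : Matrix k k R)
    (hEV : Eᵀ * V = 1) (hEE : Eᵀ * E = 1) :
    ((1 - V * Eᵀ) * (1 - V * Eᵀ)ᵀ + E * K * Eᵀ).det = (Vᵀ * V).det * K.det := by
  have hVE : Vᵀ * E = 1 := by simpa using congrArg transpose hEV
  have hfac : (1 - V * Eᵀ) * (1 - V * Eᵀ)ᵀ + E * K * Eᵀ =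
      (1 + (V - E) * (V - E)ᵀ) * (1 + E * ((K - 1) * Eᵀ)) := by
    have h : (V - E)ᵀ * E = 0 := by simp [Matrix.sub_mul, hVE, hEE]
    have h' : (V - E) * (V - E)ᵀ * (E * ((K - 1) * Eᵀ)) = 0 := by
      rw [Matrix.mul_assoc, ← Matrix.mul_assoc (V - E)ᵀ, h]; simp
    have h'' : V * Eᵀ * (E * Vᵀ) = V * Vᵀ := by
      rw [Matrix.mul_assoc, ← Matrix.mul_assoc Eᵀ, hEE, Matrix.one_mul]
    rw [add_mul, mul_add (_ * _), h']
    simp only [transpose_sub, transpose_mul, transpose_one, transpose_transpose, mul_sub, sub_mul,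
      Matrix.mul_sub, Matrix.sub_mul, h'', mul_one, one_mul, Matrix.one_mul, Matrix.mul_assoc]
    abel
  rw [hfac, det_mul, det_one_add_mul_comm, det_one_add_mul_comm E, Matrix.mul_assoc, hEE]
  congr 2
  · simp only [transpose_sub, Matrix.mul_sub, Matrix.sub_mul, hEV, hVE, hEE]
    abel
  · simp

/-- If the range of the symmetric matrix `W` is spanned by the columns of `V`, on which `W` acts
as the scalar `ν`, then `QᵀQ + WᵀW` is similar to `QQᵀ + ν² EEᵀ` for `Q = 1 - V Eᵀ`. -/
lemma det_transpose_oblique_mul_add [IsDomain R] (V E : Matrix n k R) (W : Matrix n n R)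
    (D : Matrix k n R) (ν : R) (hEV : Eᵀ * V = 1) (hEE : Eᵀ * E = 1) (hW : Wᵀ = W)
    (hWD : W = V * D) (hWV : W * V = ν • V) (hV : (Vᵀ * V).det ≠ 0) :
    ((1 - V * Eᵀ)ᵀ * (1 - V * Eᵀ) + Wᵀ * W).det =
      (Vᵀ * V).det * (ν ^ 2) ^ Fintype.card k := by
  set Q := 1 - V * Eᵀ with hQ
  have hQV : Q * V = 0 := by
    rw [hQ, Matrix.sub_mul, Matrix.mul_assoc, hEV]; simp
  have hEQ : Eᵀ * Q = 0 := by
    rw [hQ, Matrix.mul_sub, ← Matrix.mul_assoc, hEV]; simp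
  have hVQ : Vᵀ * Qᵀ = 0 := by simpa using congrArg transpose hQV
  have hQE : Qᵀ * E = 0 := by simpa using congrArg transpose hEQ
  have hQW : Q * W = 0 := by rw [hWD, ← Matrix.mul_assoc, hQV, Matrix.zero_mul]
  have hVW : Vᵀ * W = ν • Vᵀ := by simpa [hW] using congrArg transpose hWV
  have hVWW : Vᵀ * (W * W) = ν ^ 2 • Vᵀ := by
    rw [← Matrix.mul_assoc, hVW, Matrix.smul_mul, hVW, smul_smul, sq]
  set T := Q + E * Vᵀ with hT
  have hTT : T * Tᵀ = Q * Qᵀ + E * (Vᵀ * V) * Eᵀ := by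
    have h : Q * (V * Eᵀ) = 0 := by rw [← Matrix.mul_assoc, hQV, Matrix.zero_mul]
    simp [hT, add_mul, mul_add, Matrix.mul_assoc, h, hVQ]
  have hTdet : T.det ≠ 0 := by
    intro h
    have h2 := congrArg det hTT
    rw [det_mul, h, zero_mul, hQ, det_oblique_mul_transpose_add V E _ hEV hEE] at h2
    exact mul_ne_zero hV hV h2.symm
  have hsim : T * (Qᵀ * Q + Wᵀ * W) = (Q * Qᵀ + E * (ν ^ 2 • (1 : Matrix k k R)) * Eᵀ) * T := by
    have h1 : Vᵀ * (Qᵀ * Q) = 0 := by rw [← Matrix.mul_assoc, hVQ, Matrix.zero_mul]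
    have h2 : Qᵀ * (E * Vᵀ) = 0 := by rw [← Matrix.mul_assoc, hQE, Matrix.zero_mul]
    have h3 : Eᵀ * (E * Vᵀ) = Vᵀ := by rw [← Matrix.mul_assoc, hEE, Matrix.one_mul]
    have h4 : Q * (W * W) = 0 := by rw [← Matrix.mul_assoc, hQW, Matrix.zero_mul]
    simp [hT, hW, add_mul, mul_add, Matrix.mul_assoc, h1, h2, h3, h4, hEQ, hVWW]
  have hdet := congrArg det hsim
  rw [det_mul, det_mul, mul_comm T.det] at hdet
  rw [mul_right_cancel₀ hTdet hdet, hQ, det_oblique_mul_transpose_add V E _ hEV hEE]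
  simp

lemma det_one_add_allOnes : (1 + Matrix.of fun _ _ : k => (1 : R)).det = Fintype.card k + 1 := by
  have h : (Matrix.of fun _ _ : k => (1 : R)) =
      replicateCol Unit (fun _ : k => (1 : R)) * replicateRow Unit (fun _ : k => (1 : R)) := by
    ext
    simp [Matrix.mul_apply]
  rw [h, det_one_add_mul_comm, det_unique]
  simp [Matrix.mul_apply, add_comm]

end Determinants

/-- The matrix whose columns are the vectors `v_j`, for the classes `j` other than the first. -/
def classDiff (s k : ℕ) : Matrix (Fin (s + 1) × Fin (k + 1)) (Fin s) ℝ :=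
  Matrix.of fun p j => (if p.1 = j.succ then 1 else 0) - (if p.1 = 0 then 1 else 0)

/-- The matrix whose columns are the standard basis vectors of the last vertices of the classes
other than the first. -/
def lastVertex (s k : ℕ) : Matrix (Fin (s + 1) × Fin (k + 1)) (Fin s) ℝ :=
  Matrix.of fun p j => if p = (j.succ, Fin.last k) then 1 else 0

lemma lastVertex_transpose_mul {s k : ℕ} {ι : Type*}
    (A : Matrix (Fin (s + 1) × Fin (k + 1)) ι ℝ) (i : Fin s) (j : ι) :
    ((lastVertex s k)ᵀ * A) i j = A (i.succ, Fin.last k) j := by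
  simp [Matrix.mul_apply, lastVertex]

lemma lastVertex_transpose_mul_classDiff (s k : ℕ) :
    (lastVertex s k)ᵀ * classDiff s k = 1 := by
  ext i j
  simp [lastVertex_transpose_mul, classDiff, Matrix.one_apply, Fin.succ_ne_zero]

lemma lastVertex_transpose_mul_self (s k : ℕ) :
    (lastVertex s k)ᵀ * lastVertex s k = 1 := by
  ext i j
  rw [lastVertex_transpose_mul]
  simp [lastVertex, Matrix.one_apply]

lemma Qmat_eq_one_sub (s k : ℕ) :
    Qmat (s + 1) (k + 1) = 1 - classDiff s k * (lastVertex s k)ᵀ := by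
  ext p ⟨a, b⟩
  simp only [Qmat, Matrix.of_apply, Matrix.sub_apply, Matrix.one_apply, Matrix.mul_apply,
    Matrix.transpose_apply, classDiff, lastVertex, Prod.mk.injEq]
  congr 1
  have hb : (b.val = k + 1 - 1) ↔ b = Fin.last k := by simp [Fin.ext_iff]
  simp only [hb, Fin.val_eq_zero_iff]
  refine Fin.cases ?_ (fun i => ?_) a
  · simp [(Fin.succ_ne_zero _).symm]
  · by_cases h : b = Fin.last k <;> simp [h]

lemma classDiff_transpose_mul_self (s k : ℕ) :
    (classDiff s k)ᵀ * classDiff s k = ((k : ℝ) + 1) • (1 + Matrix.of fun _ _ => 1) := by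
  ext i j
  simp only [Matrix.mul_apply, classDiff, Fintype.sum_prod_type_right, Matrix.transpose_apply,
    Matrix.of_apply, Fin.sum_univ_succ]
  simp [(Fin.succ_ne_zero _).symm, Matrix.one_apply, eq_comm]
  split_ifs <;> ring

lemma Wmat_transpose (r m : ℕ) (Λ : ℝ) : (Wmat r m Λ)ᵀ = Wmat r m Λ := by
  ext p q
  simp [Wmat, Bmat, Jmat, eq_comm]

lemma Wmat_eq_classDiff_mul (s k : ℕ) (Λ : ℝ) :
    Wmat (s + 1) (k + 1) Λ =
      classDiff s k * ((lastVertex s k)ᵀ * Wmat (s + 1) (k + 1) Λ) := by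
  ext p q
  obtain ⟨a, b⟩ := p
  obtain ⟨c, d⟩ := q
  rw [Matrix.mul_apply]
  simp only [lastVertex_transpose_mul, Wmat, Bmat, Jmat, classDiff, Matrix.of_apply,
    Matrix.smul_apply, Matrix.sub_apply, smul_eq_mul]
  refine Fin.cases ?_ (fun i => ?_) a
  · refine Fin.cases ?_ (fun l => ?_) c
    · simp [Fin.succ_ne_zero, (Fin.succ_ne_zero _).symm]
      ring
    · simp [(Fin.succ_ne_zero _).symm, ← Finset.mul_sum]
  · simp [Fin.succ_ne_zero]

lemma Wmat_mul_classDiff (s k : ℕ) (Λ : ℝ) :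
    Wmat (s + 1) (k + 1) Λ * classDiff s k =
      (√(Λ * ((k + 1 : ℕ) : ℝ) ^ (((s + 1 : ℕ) : ℤ) - 3) / (2 * (s + 1 : ℕ))) *
        ((s + 1) * (k + 1))) • classDiff s k := by
  have hB : Bmat (s + 1) (k + 1) * classDiff s k = ((k : ℝ) + 1) • classDiff s k := by
    ext p j
    simp only [Bmat, classDiff, Matrix.mul_apply, Fintype.sum_prod_type_right, Matrix.of_apply,
      Matrix.smul_apply, ite_mul, one_mul, zero_mul, Finset.sum_ite_eq, Finset.mem_univ, if_true]
    split_ifs <;> simp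
  have hJ : Jmat (s + 1) (k + 1) * classDiff s k = 0 := by
    ext p j
    simp [Jmat, classDiff, Matrix.mul_apply, Fintype.sum_prod_type_right, -Finset.sum_boole]
  rw [Wmat, Matrix.smul_mul, Matrix.sub_mul, Matrix.smul_mul, hB, hJ, sub_zero, smul_smul,
    smul_smul]
  push_cast
  rw [mul_assoc]

/-- `det(QᵗQ + WᵗW) = r^r (Λ m^r / 2)^{r−1}`. -/
theorem det_QtQ_add_WtW (r m : ℕ) (hr : 2 ≤ r) (hm : 1 ≤ m)
    (lam Λ : ℝ) (hlam : lam ∈ Set.Ioo (0 : ℝ) 1) (hΛ : Λ = lam * (1 - lam)) :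
    ((Qmat r m)ᵀ * Qmat r m + (Wmat r m Λ)ᵀ * Wmat r m Λ).det =
      (r : ℝ) ^ r * (Λ * (m : ℝ) ^ r / 2) ^ (r - 1) := by
  obtain ⟨s, rfl⟩ : ∃ s, r = s + 1 := ⟨r - 1, by omega⟩
  obtain ⟨k, rfl⟩ : ∃ k, m = k + 1 := ⟨m - 1, by omega⟩
  have hΛ0 : 0 ≤ Λ := hΛ ▸ mul_nonneg hlam.1.le (sub_nonneg.2 hlam.2.le)
  have hk : (k : ℝ) + 1 ≠ 0 := by positivity
  have hs : (s : ℝ) + 1 ≠ 0 := by positivity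
  have hC : ((classDiff s k)ᵀ * classDiff s k).det = ((k : ℝ) + 1) ^ s * (s + 1) := by
    rw [classDiff_transpose_mul_self, det_smul, det_one_add_allOnes, Fintype.card_fin]
  rw [Qmat_eq_one_sub, det_transpose_oblique_mul_add _ _ _ _ _
    (lastVertex_transpose_mul_classDiff s k) (lastVertex_transpose_mul_self s k)
    (Wmat_transpose _ _ Λ) (Wmat_eq_classDiff_mul s k Λ) (Wmat_mul_classDiff s k Λ)
    (by rw [hC]; positivity), hC, mul_pow, Real.sq_sqrt (by positivity), Fintype.card_fin,
    Nat.add_sub_cancel, zpow_sub₀ (by positivity), zpow_natCast, pow_succ ((s + 1 : ℕ) : ℝ) s,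
    mul_comm (_ ^ s) ((s : ℝ) + 1), mul_assoc, ← mul_pow, mul_comm (_ ^ s), mul_assoc, ← mul_pow]
  push_cast
  congr 2
  field_simp
end
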